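/- Let n ≥ 2 and fix signs ε_1,…,ε_n ∈ {1,−1}. There is a constant C > 0 such that for every j ∈ ℤ, every unit vector e ∈ S^{n−1}, and every φ ∈ L²(ℝⁿ), ‖P_j Q^{e_±}_{j,10} W_±(t)φ‖_{L^{∞,2}_e} ≤ C 2^{−j/2} ‖φ‖_{L²}, where the left-hand side is the L^{∞,2}_e norm of the space-time function (t,x) ↦ (P_j Q^{e_±}_{j,10} W_±(t)φ)(x). -/

import Mathlib

open MeasureTheory Complex Filter
open scoped FourierTransform RealInnerProductSpace ENNReal NNReal Topology

noncomputable section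

namespace DNLS

/-- Euclidean space ℝⁿ. -/
abbrev Eucl (n : ℕ) := EuclideanSpace ℝ (Fin n)

/-- The quadratic symbol `|ξ|²_± = Σ εᵢ ξᵢ²`. -/
def quadSym {n : ℕ} (ε : Fin n → ℝ) (ξ : Eucl n) : ℝ := ∑ i, ε i * (ξ i) ^ 2

/-- The signed vector `e_± = (ε₁e₁, …, εₙeₙ)`. -/
def epm {n : ℕ} (ε : Fin n → ℝ) (e : Eucl n) : Eucl n := WithLp.toLp 2 (fun i => ε i * e i)

/-- Fourier multiplier operator with symbol `m`. -/
def mulOp {n : ℕ} (m : Eucl n → ℂ) (f : Eucl n → ℂ) : Eucl n → ℂ :=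
  𝓕⁻ (fun ξ => m ξ * 𝓕 f ξ)

/-- The propagator `W_±(t)`, with `(W_±(t)φ)^(ξ) = e^{-it|ξ|²_±} φ̂(ξ)`. -/
def prop {n : ℕ} (ε : Fin n → ℝ) (t : ℝ) (φ : Eucl n → ℂ) : Eucl n → ℂ :=
  mulOp (fun ξ => Complex.exp (-Complex.I * t * quadSym ε ξ)) φ

/-- Fourier multiplier operator acting in the space variable of a space-time function. -/
def mulOpT {n : ℕ} (m : Eucl n → ℂ) (u : ℝ × Eucl n → ℂ) : ℝ × Eucl n → ℂ :=
  fun p => mulOp m (fun y => u (p.1, y)) p.2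

/-- Hypotheses on the bump function χ : even, smooth, compactly supported in (-2,2),
equal to one on [-1,1]. -/
structure IsBump (χ : ℝ → ℝ) : Prop where
  smooth : ∀ k : ℕ, ContDiff ℝ k χ
  even : ∀ s, χ (-s) = χ s
  supp : ∀ s, 2 ≤ |s| → χ s = 0
  one : ∀ s, |s| ≤ 1 → χ s = 1

/-- `ψ(s) = χ(|s|) - χ(2|s|)`. -/
def psiR (χ : ℝ → ℝ) (s : ℝ) : ℝ := χ |s| - χ (2 * |s|)

/-- `ψ_{≥k}(s) = Σ_{m ≥ k} ψ(2^{-m} s)`. -/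
def psiGe (χ : ℝ → ℝ) (k : ℤ) (s : ℝ) : ℝ :=
  ∑' m : ℤ, if k ≤ m then psiR χ ((2 : ℝ) ^ (-m) * s) else 0

/-- Littlewood–Paley projection `P_j`. -/
def proj {n : ℕ} (χ : ℝ → ℝ) (j : ℤ) (f : Eucl n → ℂ) : Eucl n → ℂ :=
  mulOp (fun ξ => (psiR χ ((2 : ℝ) ^ (-j) * ‖ξ‖) : ℂ)) f

/-- Low-frequency projection `P_{≤0} = I - Σ_{j≥1} P_j`. -/
def lowProj {n : ℕ} (χ : ℝ → ℝ) (f : Eucl n → ℂ) : Eucl n → ℂ :=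
  mulOp (fun ξ => ((1 - psiGe χ 1 ‖ξ‖ : ℝ) : ℂ)) f

/-- Directional frequency cutoff `Q^{e}_{j,l}` with symbol `ψ_{≥ j-l}(ξ·e)`. -/
def qproj {n : ℕ} (χ : ℝ → ℝ) (e : Eucl n) (j l : ℤ) (f : Eucl n → ℂ) : Eucl n → ℂ :=
  mulOp (fun ξ => ((psiGe χ (j - l) (inner ℝ ξ e : ℝ) : ℝ) : ℂ)) f

/-- `P_j` acting in the space variable of a space-time function. -/
def projT {n : ℕ} (χ : ℝ → ℝ) (j : ℤ) (u : ℝ × Eucl n → ℂ) : ℝ × Eucl n → ℂ :=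
  fun p => proj χ j (fun y => u (p.1, y)) p.2

/-- `P_{≤0}` acting in the space variable of a space-time function. -/
def lowProjT {n : ℕ} (χ : ℝ → ℝ) (u : ℝ × Eucl n → ℂ) : ℝ × Eucl n → ℂ :=
  fun p => lowProj χ (fun y => u (p.1, y)) p.2

/-- `Q^{e}_{j,l}` acting in the space variable of a space-time function. -/
def qprojT {n : ℕ} (χ : ℝ → ℝ) (e : Eucl n) (j l : ℤ) (u : ℝ × Eucl n → ℂ) :
    ℝ × Eucl n → ℂ :=
  fun p => qproj χ e j l (fun y => u (p.1, y)) p.2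

/-- The hyperplane `P_e = {ξ : ξ·e = 0}`. -/
def hyperplane {n : ℕ} (e : Eucl n) : Submodule ℝ (Eucl n) := (ℝ ∙ e)ᗮ

/-- Inner part of the anisotropic norm: the `L^q` norm over `P_e × ℝ` of
`(t,v) ↦ u(t, re + v)`. -/
def innerQ {n : ℕ} (q : ℝ≥0∞) (e : Eucl n) (u : ℝ × Eucl n → ℂ) (r : ℝ) : ℝ≥0∞ :=
  eLpNorm (fun tv : ℝ × (hyperplane e) => u (tv.1, r • e + (tv.2 : Eucl n))) q volume

/-- The anisotropic norm `‖u‖_{L^{p,q}_e}`. -/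
def aniNorm {n : ℕ} (p q : ℝ≥0∞) (e : Eucl n) (u : ℝ × Eucl n → ℂ) : ℝ≥0∞ :=
  if p = ∞ then essSup (innerQ q e u) volume
  else (∫⁻ r : ℝ, innerQ q e u r ^ p.toReal) ^ (1 / p.toReal)

/-- The mixed space-time norm `‖u‖_{L^q_t L^r_x}`. -/
def mixNorm {n : ℕ} (q r : ℝ≥0∞) (u : ℝ × Eucl n → ℂ) : ℝ≥0∞ :=
  if q = ∞ then essSup (fun t => eLpNorm (fun x => u (t, x)) r volume) volume
  else (∫⁻ t : ℝ, eLpNorm (fun x => u (t, x)) r volume ^ q.toReal) ^ (1 / q.toReal)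

/-- `2^a` as an extended nonnegative real. -/
def tp (a : ℝ) : ℝ≥0∞ := ENNReal.ofReal ((2 : ℝ) ^ a)

/-- Homogeneous Besov norm `‖φ‖_{Ḃ^s_{2,1}}`. -/
def homBesov {n : ℕ} (χ : ℝ → ℝ) (s : ℝ) (φ : Eucl n → ℂ) : ℝ≥0∞ :=
  ∑' j : ℤ, tp (s * j) * eLpNorm (proj χ j φ) 2 volume

/-- Inhomogeneous Besov norm `‖φ‖_{B^s_{2,1}}`. -/
def besov {n : ℕ} (χ : ℝ → ℝ) (s : ℝ) (φ : Eucl n → ℂ) : ℝ≥0∞ :=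
  eLpNorm (lowProj χ φ) 2 volume
    + ∑' j : ℕ, tp (s * (j + 1)) * eLpNorm (proj χ (j + 1) φ) 2 volume

/-- The supremum over unit vectors, auxiliary notation. -/
def sphSup {n : ℕ} (g : Eucl n → ℝ≥0∞) : ℝ≥0∞ := ⨆ (e : Eucl n) (_ : ‖e‖ = 1), g e

/-- `‖P_j u‖_{M^m_j} = 2^{-(n/2-1/(m-1))j} sup_e ‖P_j u‖_{L^{m-1,∞}_e}`. -/
def MmJ {n : ℕ} (χ : ℝ → ℝ) (m : ℕ) (j : ℤ) (u : ℝ × Eucl n → ℂ) : ℝ≥0∞ :=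
  tp (-((n : ℝ) / 2 - 1 / ((m : ℝ) - 1)) * j)
    * sphSup (fun e => aniNorm ((m : ℝ≥0∞) - 1) ∞ e (projT χ j u))

/-- `‖P_j u‖_{S_j} = 2^{j/2} sup_e ‖P_j Q^{e_±}_{j,20} u‖_{L^{∞,2}_e}`. -/
def SJ {n : ℕ} (ε : Fin n → ℝ) (χ : ℝ → ℝ) (j : ℤ) (u : ℝ × Eucl n → ℂ) : ℝ≥0∞ :=
  tp ((j : ℝ) / 2)
    * sphSup (fun e => aniNorm ∞ 2 e (projT χ j (qprojT χ (epm ε e) j 20 u)))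

/-- `‖P_j u‖_{T_j} = ‖P_j u‖_{L^∞_t L²_x}`. -/
def TJ {n : ℕ} (χ : ℝ → ℝ) (j : ℤ) (u : ℝ × Eucl n → ℂ) : ℝ≥0∞ :=
  mixNorm ∞ 2 (projT χ j u)

/-- `‖P_j u‖_{Y^m_j}`. -/
def YmJ {n : ℕ} (ε : Fin n → ℝ) (χ : ℝ → ℝ) (m : ℕ) (j : ℤ) (u : ℝ × Eucl n → ℂ) : ℝ≥0∞ :=
  MmJ χ m j u + SJ ε χ j u + TJ χ j u

/-- The homogeneous resolution norm `‖u‖_{Ż^σ_{2,1}}`. -/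
def Zhom {n : ℕ} (ε : Fin n → ℝ) (χ : ℝ → ℝ) (m : ℕ) (σ : ℝ) (u : ℝ × Eucl n → ℂ) : ℝ≥0∞ :=
  ∑' j : ℤ, tp (σ * j) * YmJ ε χ m j u

/-- `N_j`-norm of a function: `2^{-j/2} sup_e ‖f‖_{L^{1,2}_e}`. -/
def NJraw {n : ℕ} (j : ℤ) (f : ℝ × Eucl n → ℂ) : ℝ≥0∞ :=
  tp (-(j : ℝ) / 2) * sphSup (fun e => aniNorm 1 2 e f)

/-- `‖P_j u‖_{N_j}`. -/
def NJ {n : ℕ} (χ : ℝ → ℝ) (j : ℤ) (u : ℝ × Eucl n → ℂ) : ℝ≥0∞ :=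
  NJraw j (projT χ j u)

/-- The homogeneous nonlinear norm `‖F‖_{Ṅ^σ_{2,1}}`. -/
def Nhom {n : ℕ} (χ : ℝ → ℝ) (σ : ℝ) (F : ℝ × Eucl n → ℂ) : ℝ≥0∞ :=
  ∑' j : ℤ, tp (σ * j) * NJ χ j F

/-- `‖P_j u‖_{T̃_j} = ‖P_j u‖_{L^∞_t L²_x} + ‖P_j u‖_{L^{2+4/n}_{t,x}}`. -/
def TtilJ {n : ℕ} (χ : ℝ → ℝ) (j : ℤ) (u : ℝ × Eucl n → ℂ) : ℝ≥0∞ :=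
  mixNorm ∞ 2 (projT χ j u)
    + eLpNorm (projT χ j u) (ENNReal.ofReal (2 + 4 / (n : ℝ))) volume

/-- `‖P_j u‖_{M̃_j} = sup_{p ∈ ℤ, p ≥ 2, np ≥ 6} sup_e 2^{(n/2-1/p)j}‖P_j u‖_{L^{p,∞}_e}`. -/
def MtilJ {n : ℕ} (χ : ℝ → ℝ) (j : ℤ) (u : ℝ × Eucl n → ℂ) : ℝ≥0∞ :=
  ⨆ (p : ℕ) (_ : 2 ≤ p ∧ 6 ≤ n * p),
    sphSup (fun e => tp (((n : ℝ) / 2 - 1 / (p : ℝ)) * j) * aniNorm (p : ℝ≥0∞) ∞ e (projT χ j u))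

/-- `‖P_j u‖_{Ỹ_j}`. -/
def YtilJ {n : ℕ} (ε : Fin n → ℝ) (χ : ℝ → ℝ) (j : ℤ) (u : ℝ × Eucl n → ℂ) : ℝ≥0∞ :=
  MtilJ χ j u + SJ ε χ j u + TtilJ χ j u

/-- The inhomogeneous resolution norm `‖u‖_{Z̃^σ_{2,1}}`. -/
def Ztil {n : ℕ} (ε : Fin n → ℝ) (χ : ℝ → ℝ) (σ : ℝ) (u : ℝ × Eucl n → ℂ) : ℝ≥0∞ :=
  (∑' j : ℤ, if j ≤ 0 then YtilJ ε χ j u ^ 2 else 0) ^ ((1 : ℝ) / 2)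
    + ∑' j : ℤ, if 1 ≤ j then tp (σ * j) * YtilJ ε χ j u else 0

/-- `‖f‖_{Ñ_j}`: infimum over decompositions `f = v + w`. -/
def NtilJraw {n : ℕ} (j : ℤ) (f : ℝ × Eucl n → ℂ) : ℝ≥0∞ :=
  ⨅ (vw : (ℝ × Eucl n → ℂ) × (ℝ × Eucl n → ℂ)) (_ : f = vw.1 + vw.2),
    NJraw j vw.1 + eLpNorm vw.2 (ENNReal.ofReal ((2 * (n : ℝ) + 4) / ((n : ℝ) + 4))) volume

/-- The inhomogeneous nonlinear norm `‖F‖_{Ñ^σ_{2,1}}`. -/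
def Ntil {n : ℕ} (χ : ℝ → ℝ) (σ : ℝ) (F : ℝ × Eucl n → ℂ) : ℝ≥0∞ :=
  (∑' j : ℤ, if j ≤ 0 then NtilJraw j (projT χ j F) ^ 2 else 0) ^ ((1 : ℝ) / 2)
    + ∑' j : ℤ, if 1 ≤ j then tp (σ * j) * NtilJraw j (projT χ j F) else 0

/-- `k`-th spatial partial derivative of a space-time function. -/
def pd {n : ℕ} (k : ℕ) (u : ℝ × Eucl n → ℂ) (p : ℝ × Eucl n) : ℂ :=
  if h : k < n then fderiv ℝ (fun y => u (p.1, y)) p.2 (EuclideanSpace.single ⟨k, h⟩ (1 : ℝ))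
  else 0

/-- The retarded Duhamel integral `∫_0^t W_±(t-s) G(s) ds`. -/
def duhamel {n : ℕ} (ε : Fin n → ℝ) (G : ℝ × Eucl n → ℂ) (p : ℝ × Eucl n) : ℂ :=
  ∫ s in (0 : ℝ)..p.1, prop ε (p.1 - s) (fun y => G (s, y)) p.2

/-- Admissible Strichartz pair: `2/q = n(1/2 - 1/r)`, `q, r ≥ 2`, and `q ≠ 2` when `n = 2`. -/
def Admissible (n : ℕ) (q r : ℝ) : Prop :=
  2 / q = (n : ℝ) * (1 / 2 - 1 / r) ∧ 2 ≤ q ∧ 2 ≤ r ∧ (n = 2 → q ≠ 2)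

/-- Value of a power series with coefficients `c` at `z`. -/
def polyVal {d : ℕ} (c : (Fin d →₀ ℕ) → ℂ) (z : Fin d → ℂ) : ℂ :=
  ∑' β : Fin d →₀ ℕ, c β * ∏ i, z i ^ β i

/-- The argument vector `(u, ū, ∇u, ∇ū)` of the general nonlinearity. -/
def nlArg {n : ℕ} (u : ℝ × Eucl n → ℂ) (p : ℝ × Eucl n) (i : Fin (2 * n + 2)) : ℂ :=
  if (i : ℕ) = 0 then u p
  else if (i : ℕ) = 1 then starRingEnd ℂ (u p)
  else if (i : ℕ) < n + 2 then pd ((i : ℕ) - 2) u p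
  else pd ((i : ℕ) - (n + 2)) (fun q => starRingEnd ℂ (u q)) p

/-- The argument vector `(∇u, ∇ū)` of a nonlinearity in `2n` variables. -/
def gradArg {n : ℕ} (u : ℝ × Eucl n → ℂ) (p : ℝ × Eucl n) (i : Fin (2 * n)) : ℂ :=
  if (i : ℕ) < n then pd (i : ℕ) u p
  else pd ((i : ℕ) - n) (fun q => starRingEnd ℂ (u q)) p

end DNLS
open DNLS

section Plancherel

variable {E : Type*} [NormedAddCommGroup E] [InnerProductSpace ℝ E] [FiniteDimensional ℝ E]
  [MeasurableSpace E] [BorelSpace E]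

lemma continuous_fourier_of_integrable {f : E → ℂ} (hf : Integrable f) : Continuous (𝓕 f) :=
  VectorFourier.fourierIntegral_continuous Real.continuous_fourierChar continuous_inner hf

lemma fourier_eq_zero_of_not_integrable {f : E → ℂ} (hf : ¬ Integrable f) : 𝓕 f = 0 := by
  ext w
  rw [Real.fourier_eq]
  exact integral_undef (mt (Real.fourierIntegral_convergent_iff w).1 hf)

lemma fourierInv_eq_zero_of_not_integrable {f : E → ℂ} (hf : ¬ Integrable f) : 𝓕⁻ f = 0 := by
  ext w
  rw [Real.fourierInv_eq_fourier_neg, fourier_eq_zero_of_not_integrable hf]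
  rfl

/-- The integral Fourier transform of an `L¹ ∩ L²` function agrees a.e. with the `L²` one. -/
lemma fourier_ae_eq_fourier_toLp {f : E → ℂ} (hf : Integrable f) (hf2 : MemLp f 2) :
    𝓕 f =ᵐ[volume] (𝓕 (hf2.toLp f) : Lp ℂ 2 (volume : Measure E)) := by
  refine ae_eq_of_integral_contDiff_smul_eq
    (continuous_fourier_of_integrable hf).locallyIntegrable
    ((Lp.memLp _).locallyIntegrable one_le_two) ?_
  intro g g_smooth g_cpt
  have hg₁ : HasCompactSupport (Complex.ofRealCLM ∘ g) := g_cpt.comp_left rfl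
  have hg₂ : ContDiff ℝ (⊤ : ℕ∞) (Complex.ofRealCLM ∘ g) := by fun_prop
  set G := hg₁.toSchwartzMap hg₂ with hG
  have hGg : ∀ x, G x = (g x : ℂ) := fun x => rfl
  have key := congrArg (fun T => T G) (Lp.fourier_toTemperedDistribution_eq (hf2.toLp f))
  simp only [TemperedDistribution.fourier_apply, Lp.toTemperedDistribution_apply] at key
  have h1 : ∫ x, g x • 𝓕 f x = ∫ x, G x • 𝓕 f x := by
    refine integral_congr_ae (.of_forall fun x => ?_)
    simp [hGg]
  have h2 : ∫ x, g x • (𝓕 (hf2.toLp f) : Lp ℂ 2 (volume : Measure E)) x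
      = ∫ x, G x • (𝓕 (hf2.toLp f) : Lp ℂ 2 (volume : Measure E)) x := by
    refine integral_congr_ae (.of_forall fun x => ?_)
    simp [hGg]
  rw [h1, h2, ← key]
  have h3 : ∫ x, (𝓕 G) x • (hf2.toLp f) x = ∫ x, (𝓕 G) x • f x := by
    refine integral_congr_ae ?_
    filter_upwards [hf2.coeFn_toLp] with x hx
    rw [hx]
  rw [h3]
  have := VectorFourier.integral_fourierIntegral_smul_eq_flip (L := innerₗ E) (μ := volume)
    (ν := volume) Real.continuous_fourierChar continuous_inner (G.integrable) hf
  simp only [flip_innerₗ] at this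
  exact this.symm

/-- Plancherel's inequality for the integral Fourier transform. -/
lemma eLpNorm_fourier_le {f : E → ℂ} (hf2 : MemLp f 2) :
    eLpNorm (𝓕 f) 2 volume ≤ eLpNorm f 2 volume := by
  by_cases hf : Integrable f
  · rw [eLpNorm_congr_ae (fourier_ae_eq_fourier_toLp hf hf2), ← Lp.enorm_def,
      ← ofReal_norm, Lp.norm_fourier_eq, ofReal_norm, Lp.enorm_toLp]
  · rw [fourier_eq_zero_of_not_integrable hf]
    simp

lemma eLpNorm_fourierInv_le {f : E → ℂ} (hf2 : MemLp f 2) :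
    eLpNorm (𝓕⁻ f) 2 volume ≤ eLpNorm f 2 volume := by
  rw [Real.fourierInv_eq_fourier_comp_neg]
  have hneg := Measure.measurePreserving_neg (volume : Measure E)
  refine (eLpNorm_fourier_le (hf2.comp_measurePreserving hneg)).trans_eq ?_
  exact eLpNorm_comp_measurePreserving hf2.1 hneg

lemma continuous_fourierInv_of_integrable {f : E → ℂ} (hf : Integrable f) :
    Continuous (𝓕⁻ f) := by
  rw [Real.fourierInv_eq_fourier_comp_neg]
  exact continuous_fourier_of_integrable hf.comp_neg

lemma fourier_fourierInv_eq_or_eq_zero {f : E → ℂ} (hc : Continuous f) (hf : Integrable f) :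
    𝓕 (𝓕⁻ f) = f ∨ 𝓕 (𝓕⁻ f) = 0 := by
  by_cases h : Integrable (𝓕⁻ f)
  · left
    refine hc.fourier_fourierInv_eq hf ?_
    have : 𝓕 f = fun x => 𝓕⁻ f (-x) := by
      ext x
      rw [Real.fourierInv_eq_fourier_neg, neg_neg]
    rw [this]
    exact h.comp_neg
  · exact .inr (fourier_eq_zero_of_not_integrable h)

/-- If a Fourier integral operator with phase `⟪T ξ, w⟫` lives on a set where `T` is injective,
then it is an inverse Fourier transform of a function obtained by change of variables. -/
lemma eLpNorm_oscillatory_integral_le {T : E → E} {T' : E → E →L[ℝ] E} {H : Set E}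
    (hH : MeasurableSet H) (hT : ∀ x ∈ H, HasFDerivWithinAt T (T' x) H x) (hinj : Set.InjOn T H)
    {c : ℝ} (hc : 0 < c) (hdet : ∀ x ∈ H, c ≤ |(T' x).det|) {h : E → ℂ} (hh : IntegrableOn h H)
    (hh2 : MemLp h 2) :
    Continuous (fun w : E => ∫ ξ in H, Complex.exp (↑(2 * Real.pi * ⟪T ξ, w⟫) * Complex.I) • h ξ) ∧
    eLpNorm (fun w : E => ∫ ξ in H, Complex.exp (↑(2 * Real.pi * ⟪T ξ, w⟫) * Complex.I) • h ξ) 2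
      volume ≤ ENNReal.ofReal (√c)⁻¹ * eLpNorm h 2 volume := by
  set S := Function.invFunOn T H
  have hS : ∀ x ∈ H, S (T x) = x := fun x hx => hinj.leftInvOn_invFunOn hx
  set g : E → ℂ := fun y => (|(T' (S y)).det|)⁻¹ • h (S y)
  have hTH : MeasurableSet (T '' H) := measurable_image_of_fderivWithin hH hT hinj
  have hgT : ∀ x ∈ H, |(T' x).det| • g (T x) = h x := by
    intro x hx
    have : |(T' x).det| ≠ 0 := (hc.trans_le (hdet x hx)).ne'
    simp only [g, hS x hx, smul_smul, mul_inv_cancel₀ this, one_smul]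
  have hgi : IntegrableOn g (T '' H) := by
    rw [integrableOn_image_iff_integrableOn_abs_det_fderiv_smul volume hH hT hinj]
    exact hh.congr_fun (fun x hx => (hgT x hx).symm) hH
  set G : E → ℂ := (T '' H).indicator g
  have hG : Integrable G := hgi.integrable_indicator hTH
  have hGF : (fun w : E => ∫ ξ in H, Complex.exp (↑(2 * Real.pi * ⟪T ξ, w⟫) * Complex.I) • h ξ)
      = 𝓕⁻ G := by
    ext w
    rw [Real.fourierInv_eq']
    have : (fun v => Complex.exp (↑(2 * Real.pi * ⟪v, w⟫) * Complex.I) • G v) =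
        (T '' H).indicator
          (fun v => Complex.exp (↑(2 * Real.pi * ⟪v, w⟫) * Complex.I) • g v) := by
      ext v
      by_cases hv : v ∈ T '' H <;> simp [G, hv]
    rw [this, integral_indicator hTH,
      integral_image_eq_integral_abs_det_fderiv_smul volume hH hT hinj]
    refine setIntegral_congr_fun hH fun x hx => ?_
    rw [smul_comm, hgT x hx]
  have hbound : eLpNorm G 2 volume ≤ ENNReal.ofReal (√c)⁻¹ * eLpNorm h 2 volume := by
    have h0 : eLpNorm ((√c)⁻¹ • h) 2 volume = ENNReal.ofReal (√c)⁻¹ * eLpNorm h 2 volume := by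
      rw [eLpNorm_const_smul, Real.enorm_eq_ofReal (by positivity)]
    rw [← h0, eLpNorm_eq_lintegral_rpow_enorm_toReal two_ne_zero ENNReal.ofNat_ne_top,
      eLpNorm_eq_lintegral_rpow_enorm_toReal two_ne_zero ENNReal.ofNat_ne_top]
    refine ENNReal.rpow_le_rpow ?_ (by norm_num)
    have : (fun y => ‖G y‖ₑ ^ (2 : ℝ≥0∞).toReal)
        = (T '' H).indicator (fun y => ‖g y‖ₑ ^ (2 : ℝ≥0∞).toReal) := by
      ext v
      by_cases hv : v ∈ T '' H <;> simp [G, hv]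
    rw [this, lintegral_indicator hTH,
      lintegral_image_eq_lintegral_abs_det_fderiv_mul volume hH hT hinj]
    refine (setLIntegral_mono' hH fun x hx => ?_).trans (setLIntegral_le_lintegral H _)
    have hpos : 0 < |(T' x).det| := hc.trans_le (hdet x hx)
    simp only [g, hS x hx, Pi.smul_apply, ENNReal.toReal_ofNat, ENNReal.rpow_ofNat, enorm_smul,
      mul_pow, ← mul_assoc]
    gcongr
    rw [Real.enorm_eq_ofReal (by positivity), Real.enorm_eq_ofReal (by positivity),
      ← ENNReal.ofReal_pow (by positivity), ← ENNReal.ofReal_pow (by positivity),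
      ← ENNReal.ofReal_mul (by positivity)]
    refine ENNReal.ofReal_le_ofReal ?_
    rw [inv_pow, inv_pow, Real.sq_sqrt hc.le, pow_two, mul_inv, mul_inv_cancel_left₀ hpos.ne']
    exact inv_anti₀ hc (hdet x hx)
  have hG2 : MemLp G 2 :=
    ⟨hG.1, hbound.trans_lt (ENNReal.mul_lt_top ENNReal.ofReal_lt_top hh2.2)⟩
  rw [hGF]
  exact ⟨continuous_fourierInv_of_integrable hG, (eLpNorm_fourierInv_le hG2).trans hbound⟩

end Plancherel

section Multipliers

variable {χ : ℝ → ℝ}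

lemma psiGe_eq (hχ : IsBump χ) (k : ℤ) (s : ℝ) :
    psiGe χ k s = 1 - χ ((2 : ℝ) ^ (1 - k) * |s|) := by
  set b : ℕ → ℝ := fun i => χ ((2 : ℝ) ^ (1 - (k + i)) * |s|) with hb
  have hinj : Function.Injective (fun i : ℕ => k + (i : ℤ)) := fun a b h => by
    simpa using h
  have hterm : ∀ i : ℕ, psiR χ ((2 : ℝ) ^ (-(k + (i : ℤ))) * s) = b (i + 1) - b i := by
    intro i
    simp only [psiR, hb, abs_mul, abs_of_pos (zpow_pos (two_pos : (0 : ℝ) < 2) _), ← mul_assoc]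
    rw [← zpow_one_add₀ two_ne_zero]
    congr 4
    all_goals
      push_cast
      ring
  obtain ⟨N, hN⟩ : ∃ N : ℕ, (2 : ℝ) ^ (1 - k) * |s| ≤ 2 ^ N := by
    obtain ⟨N, hN⟩ := pow_unbounded_of_one_lt ((2 : ℝ) ^ (1 - k) * |s|) one_lt_two
    exact ⟨N, hN.le⟩
  have hb1 : ∀ i, N ≤ i → b i = 1 := by
    intro i hi
    refine hχ.one _ ?_
    rw [abs_of_nonneg (by positivity)]
    have : (2 : ℝ) ^ (1 - (k + (i : ℤ))) = 2 ^ (1 - k) / 2 ^ i := by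
      rw [← sub_sub, zpow_sub₀ two_ne_zero, zpow_natCast]
    rw [this, div_mul_eq_mul_div, div_le_one (by positivity)]
    exact hN.trans (pow_le_pow_right₀ one_le_two hi)
  have hsupp : Function.support (fun m : ℤ => if k ≤ m then psiR χ ((2 : ℝ) ^ (-m) * s) else 0)
      ⊆ Set.range (fun i : ℕ => k + (i : ℤ)) := by
    intro m hm
    have : k ≤ m := by
      by_contra h
      simp [h] at hm
    exact ⟨(m - k).toNat, by simp only; omega⟩
  rw [psiGe, ← hinj.tsum_eq hsupp, tsum_eq_sum (s := Finset.range N)]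
  · simp only [le_add_iff_nonneg_right, Nat.cast_nonneg, if_true, hterm]
    rw [Finset.sum_range_sub, hb1 N le_rfl]
    simp [hb]
  · intro i hi
    rw [Finset.mem_range, not_lt] at hi
    simp only [le_add_iff_nonneg_right, Nat.cast_nonneg, if_true, hterm]
    rw [hb1 i hi, hb1 (i + 1) (by omega), sub_self]

lemma DNLS.IsBump.continuous (hχ : IsBump χ) : Continuous χ := (hχ.smooth 0).continuous

lemma DNLS.IsBump.exists_abs_le (hχ : IsBump χ) : ∃ M, ∀ s, |χ s| ≤ M := by
  have : HasCompactSupport χ := HasCompactSupport.intro (isCompact_Icc (a := -2) (b := 2))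
    fun x hx => hχ.supp x (by
      by_contra h
      exact hx (abs_le.1 (not_le.1 h).le))
  simpa using hχ.continuous.bounded_above_of_compact_support this

lemma psiGe_eq_zero (hχ : IsBump χ) {k : ℤ} {s : ℝ} (hs : |s| ≤ 2 ^ (k - 1)) :
    psiGe χ k s = 0 := by
  rw [psiGe_eq hχ, hχ.one, sub_self]
  rw [abs_of_nonneg (by positivity)]
  calc (2 : ℝ) ^ (1 - k) * |s| ≤ 2 ^ (1 - k) * 2 ^ (k - 1) := by gcongr
    _ = 1 := by rw [← zpow_add₀ two_ne_zero]; simp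

variable {n : ℕ}

/-- The symbol of `P_j Q^{d}_{j,l}`. -/
def dirSymbol (χ : ℝ → ℝ) (d : Eucl n) (j l : ℤ) (ξ : Eucl n) : ℂ :=
  (psiR χ ((2 : ℝ) ^ (-j) * ‖ξ‖) : ℂ) * ((psiGe χ (j - l) (inner ℝ ξ d : ℝ) : ℝ) : ℂ)

lemma DNLS.IsBump.continuous_psiR (hχ : IsBump χ) (j : ℤ) :
    Continuous fun ξ : Eucl n => (psiR χ ((2 : ℝ) ^ (-j) * ‖ξ‖) : ℂ) := by
  have := hχ.continuous
  unfold psiR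
  fun_prop

lemma DNLS.IsBump.continuous_psiGe (hχ : IsBump χ) (d : Eucl n) (k : ℤ) :
    Continuous fun ξ : Eucl n => ((psiGe χ k (inner ℝ ξ d : ℝ) : ℝ) : ℂ) := by
  have := hχ.continuous
  simp only [psiGe_eq hχ]
  fun_prop

lemma DNLS.IsBump.continuous_dirSymbol (hχ : IsBump χ) (d : Eucl n) (j l : ℤ) :
    Continuous (dirSymbol χ d j l) :=
  (hχ.continuous_psiR j).mul (hχ.continuous_psiGe d (j - l))

lemma norm_psiR_le {M : ℝ} (hM : ∀ s, |χ s| ≤ M) (s : ℝ) : ‖(psiR χ s : ℂ)‖ ≤ 2 * M := by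
  rw [Complex.norm_real, Real.norm_eq_abs, psiR, two_mul M]
  exact (abs_sub _ _).trans (add_le_add (hM _) (hM _))

lemma norm_psiGe_le (hχ : IsBump χ) {M : ℝ} (hM : ∀ s, |χ s| ≤ M) (k : ℤ) (s : ℝ) :
    ‖(psiGe χ k s : ℂ)‖ ≤ 1 + M := by
  rw [Complex.norm_real, Real.norm_eq_abs, psiGe_eq hχ]
  exact (abs_sub _ _).trans (add_le_add (by simp) (hM _))

lemma norm_dirSymbol_le (hχ : IsBump χ) {M : ℝ} (hM : ∀ s, |χ s| ≤ M) (d : Eucl n) (j l : ℤ)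
    (ξ : Eucl n) : ‖dirSymbol χ d j l ξ‖ ≤ 2 * M * (1 + M) := by
  rw [dirSymbol, norm_mul]
  have h0 : 0 ≤ M := (abs_nonneg _).trans (hM 0)
  gcongr
  · exact norm_psiR_le hM _
  · exact norm_psiGe_le hχ hM _ _

lemma mulOp_zero (m : Eucl n → ℂ) : mulOp m 0 = 0 := by
  have : (𝓕 (0 : Eucl n → ℂ)) = 0 := by
    ext w
    simp [Real.fourier_eq]
  ext x
  simp [mulOp, this, Real.fourierInv_eq]

lemma mulOp_fourierInv (m : Eucl n → ℂ) {f : Eucl n → ℂ} (hc : Continuous f)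
    (hf : Integrable f) : mulOp m (𝓕⁻ f) = 𝓕⁻ (fun ξ => m ξ * f ξ) ∨ mulOp m (𝓕⁻ f) = 0 := by
  rcases fourier_fourierInv_eq_or_eq_zero hc hf with h | h
  · exact .inl (by rw [mulOp, h])
  · right
    ext x
    simp [mulOp, h, Real.fourierInv_eq]

/-- The unimodular symbol of `W_±(t)`. -/
def propSymbol (ε : Fin n → ℝ) (t : ℝ) (ξ : Eucl n) : ℂ :=
  Complex.exp (-Complex.I * t * quadSym ε ξ)

lemma continuous_quadSym (ε : Fin n → ℝ) : Continuous (quadSym ε) := by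
  unfold quadSym
  fun_prop

lemma continuous_propSymbol (ε : Fin n → ℝ) (t : ℝ) : Continuous (propSymbol ε t) := by
  have := continuous_quadSym ε
  unfold propSymbol
  fun_prop

lemma norm_propSymbol (ε : Fin n → ℝ) (t : ℝ) (ξ : Eucl n) : ‖propSymbol ε t ξ‖ = 1 := by
  have : -Complex.I * t * quadSym ε ξ = ((-(t * quadSym ε ξ) : ℝ) : ℂ) * Complex.I := by
    push_cast
    ring
  rw [propSymbol, this, Complex.norm_exp_ofReal_mul_I]

lemma integrable_propSymbol_mul_iff (ε : Fin n → ℝ) (t : ℝ) {f : Eucl n → ℂ} :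
    Integrable (fun ξ => propSymbol ε t ξ * f ξ) ↔ Integrable f := by
  have key : ∀ (s : ℝ) {g : Eucl n → ℂ}, Integrable g →
      Integrable (fun ξ => propSymbol ε s ξ * g ξ) := fun s g hg =>
    hg.bdd_mul (continuous_propSymbol ε s).aestronglyMeasurable
      (.of_forall fun ξ => (norm_propSymbol ε s ξ).le)
  refine ⟨fun h => ?_, key t⟩
  have heq : (fun ξ => propSymbol ε (-t) ξ * (propSymbol ε t ξ * f ξ)) = f := by
    ext ξ
    rw [← mul_assoc, propSymbol, propSymbol, ← Complex.exp_add]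
    push_cast
    ring_nf
    simp
  exact heq ▸ key (-t) h

/-- Because the Fourier transforms are integrals with junk value `0`, each iterated multiplier
is either given by the expected oscillatory integral or vanishes. -/
lemma norm_proj_qproj_prop_le (hχ : IsBump χ) (ε : Fin n → ℝ) (d : Eucl n) (j l : ℤ) (t : ℝ)
    {φ : Eucl n → ℂ} (hc : Continuous (𝓕 φ)) (hf : Integrable (𝓕 φ)) (x : Eucl n) :
    ‖proj χ j (qproj χ d j l (prop ε t φ)) x‖
      ≤ ‖𝓕⁻ (fun ξ => dirSymbol χ d j l ξ * (propSymbol ε t ξ * 𝓕 φ ξ)) x‖ := by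
  obtain ⟨M, hM⟩ := hχ.exists_abs_le
  have hi := (integrable_propSymbol_mul_iff ε t).2 hf
  have hcont : Continuous fun ξ => propSymbol ε t ξ * 𝓕 φ ξ := (continuous_propSymbol ε t).mul hc
  have hq : Integrable fun ξ => ((psiGe χ (j - l) (inner ℝ ξ d : ℝ) : ℝ) : ℂ) *
      (propSymbol ε t ξ * 𝓕 φ ξ) :=
    hi.bdd_mul (hχ.continuous_psiGe d (j - l)).aestronglyMeasurable
      (.of_forall fun ξ => norm_psiGe_le hχ hM _ _)
  rw [show prop ε t φ = 𝓕⁻ (fun ξ => propSymbol ε t ξ * 𝓕 φ ξ) from rfl, proj, qproj]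
  rcases mulOp_fourierInv (fun ξ => ((psiGe χ (j - l) (inner ℝ ξ d : ℝ) : ℝ) : ℂ)) hcont hi
    with h | h
  · rw [h]
    have hqc : Continuous fun ξ => ((psiGe χ (j - l) (inner ℝ ξ d : ℝ) : ℝ) : ℂ) *
        (propSymbol ε t ξ * 𝓕 φ ξ) := (hχ.continuous_psiGe d (j - l)).mul hcont
    rcases mulOp_fourierInv (fun ξ => (psiR χ ((2 : ℝ) ^ (-j) * ‖ξ‖) : ℂ)) hqc hq with h' | h'
    · rw [h']
      simp only [dirSymbol, mul_assoc, le_refl]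
    · rw [h']
      simp
  · rw [h, mulOp_zero]
    simp

lemma proj_qproj_prop_eq_zero (χ : ℝ → ℝ) (ε : Fin n → ℝ) (d : Eucl n) (j l : ℤ) (t : ℝ)
    {φ : Eucl n → ℂ} (hf : ¬ Integrable (𝓕 φ)) :
    proj χ j (qproj χ d j l (prop ε t φ)) = 0 := by
  rw [show prop ε t φ = 𝓕⁻ (fun ξ => propSymbol ε t ξ * 𝓕 φ ξ) from rfl,
    fourierInv_eq_zero_of_not_integrable (mt (integrable_propSymbol_mul_iff ε t).1 hf), proj,
    qproj, mulOp_zero, mulOp_zero]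

end Multipliers

section Geometry

variable {n : ℕ}

/-- `(t, v) ↦ t e + v` identifies `ℝ × P_e` with `ℝⁿ`, preserving volume. -/
lemma measurePreserving_line_add_hyperplane {e : Eucl n} (he : ‖e‖ = 1) :
    MeasurePreserving (fun p : ℝ × hyperplane e => p.1 • e + (p.2 : Eucl n)) := by
  have h1 := (LinearIsometryEquiv.toSpanUnitSingleton (𝕜 := ℝ) e he).measurePreserving
  have h2 := h1.prod (MeasurePreserving.id (volume : Measure (hyperplane e)))
  have h3 := (WithLp.volume_preserving_toLp (ℝ ∙ e) (hyperplane e)).comp h2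
  exact ((ℝ ∙ e).orthogonalDecomposition.symm.measurePreserving).comp h3

/-- The differential of `quadSym ε` at `ξ`. -/
def quadSymDeriv (ε : Fin n → ℝ) (ξ : Eucl n) : Eucl n →L[ℝ] ℝ :=
  ∑ i, (ε i * (2 * ξ i)) • (EuclideanSpace.proj i : Eucl n →L[ℝ] ℝ)

lemma hasFDerivAt_quadSym (ε : Fin n → ℝ) (ξ : Eucl n) :
    HasFDerivAt (quadSym ε) (quadSymDeriv ε ξ) ξ := by
  unfold quadSym quadSymDeriv
  refine HasFDerivAt.fun_sum fun i _ => ?_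
  have h := (((EuclideanSpace.proj i : Eucl n →L[ℝ] ℝ).hasFDerivAt (x := ξ)).pow 2).const_mul (ε i)
  convert! h using 1
  ext v
  simp [mul_assoc]

lemma inner_epm (ε : Fin n → ℝ) (e ξ : Eucl n) :
    ⟪ξ, epm ε e⟫ = ∑ i, ε i * e i * ξ i := by
  simp [PiLp.inner_apply, epm]

lemma quadSymDeriv_apply (ε : Fin n → ℝ) (e ξ : Eucl n) :
    quadSymDeriv ε ξ e = 2 * ⟪ξ, epm ε e⟫ := by
  rw [inner_epm, quadSymDeriv, _root_.sum_apply, Finset.mul_sum]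
  refine Finset.sum_congr rfl fun i _ => ?_
  simp
  ring

lemma quadSym_add_smul_sub (ε : Fin n → ℝ) (e ξ : Eucl n) (s : ℝ) :
    quadSym ε (ξ + s • e) - quadSym ε ξ = s * (⟪ξ, epm ε e⟫ + ⟪ξ + s • e, epm ε e⟫) := by
  rw [inner_epm, inner_epm, quadSym, quadSym, ← Finset.sum_sub_distrib, ← Finset.sum_add_distrib,
    Finset.mul_sum]
  refine Finset.sum_congr rfl fun i _ => ?_
  simp
  ring

/-- Replace the `e`-component of `ξ` by the dual time frequency `-|ξ|²_± / 2π`. -/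
def timeFreq (ε : Fin n → ℝ) (e ξ : Eucl n) : Eucl n :=
  ξ + (-(⟪e, ξ⟫ + (2 * Real.pi)⁻¹ * quadSym ε ξ)) • e

/-- The differential of `timeFreq ε e`. -/
def timeFreqDeriv (ε : Fin n → ℝ) (e ξ : Eucl n) : Eucl n →L[ℝ] Eucl n :=
  .id ℝ _ + (-(innerSL ℝ e + (2 * Real.pi)⁻¹ • quadSymDeriv ε ξ)).smulRight e

lemma hasFDerivAt_timeFreq (ε : Fin n → ℝ) (e ξ : Eucl n) :
    HasFDerivAt (timeFreq ε e) (timeFreqDeriv ε e ξ) ξ := by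
  refine (hasFDerivAt_id ξ).add (HasFDerivAt.smul_const (.neg (.add ?_ ?_)) e)
  · exact (innerSL ℝ e).hasFDerivAt
  · exact (hasFDerivAt_quadSym ε ξ).const_mul _

lemma det_timeFreqDeriv (ε : Fin n → ℝ) {e : Eucl n} (he : ‖e‖ = 1) (ξ : Eucl n) :
    (timeFreqDeriv ε e ξ).det = -(⟪ξ, epm ε e⟫ / Real.pi) := by
  have : (timeFreqDeriv ε e ξ : Eucl n →ₗ[ℝ] Eucl n) = LinearMap.transvection
      ((-(innerSL ℝ e + (2 * Real.pi)⁻¹ • quadSymDeriv ε ξ) : Eucl n →L[ℝ] ℝ) : Eucl n →ₗ[ℝ] ℝ)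
      e := by
    ext v : 1
    simp [timeFreqDeriv, LinearMap.transvection.apply]
  rw [ContinuousLinearMap.det, this, LinearMap.transvection.det]
  simp [quadSymDeriv_apply, he]
  field_simp

lemma timeFreq_injOn (ε : Fin n → ℝ) {e : Eucl n} (he : ‖e‖ = 1) {H : Set (Eucl n)}
    (hH : ∀ ξ ∈ H, ∀ η ∈ H, ⟪ξ, epm ε e⟫ + ⟪η, epm ε e⟫ ≠ 0) :
    Set.InjOn (timeFreq ε e) H := by
  intro ξ hξ η hη h
  have hee : ⟪e, e⟫ = 1 := by simp [he]
  have hin : ∀ ζ, ⟪e, timeFreq ε e ζ⟫ = -((2 * Real.pi)⁻¹ * quadSym ε ζ) := by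
    intro ζ
    rw [timeFreq, inner_add_right, inner_smul_right, hee]
    ring
  have hQ : quadSym ε ξ = quadSym ε η := by
    have := congrArg (fun z => ⟪e, z⟫) h
    simp only [hin, neg_inj] at this
    exact mul_left_cancel₀ (by positivity) this
  obtain ⟨s, rfl⟩ : ∃ s : ℝ, η = ξ + s • e := by
    refine ⟨⟪e, η⟫ - ⟪e, ξ⟫, ?_⟩
    simp only [timeFreq, hQ] at h
    have h' : ξ = η + (-(⟪e, η⟫ + (2 * Real.pi)⁻¹ * quadSym ε η)) • e
      - (-(⟪e, ξ⟫ + (2 * Real.pi)⁻¹ * quadSym ε η)) • e := by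
      rw [← h]
      abel
    nth_rewrite 1 [h']
    module
  have := quadSym_add_smul_sub ε e ξ s
  rw [← hQ, sub_self, eq_comm, mul_eq_zero, or_iff_left (hH ξ hξ _ hη)] at this
  simp [this]

lemma inner_timeFreq (ε : Fin n → ℝ) {e : Eucl n} (he : ‖e‖ = 1) (ξ : Eucl n) (t : ℝ)
    (v : hyperplane e) :
    ⟪timeFreq ε e ξ, t • e + (v : Eucl n)⟫
      = ⟪ξ, (v : Eucl n)⟫ - (2 * Real.pi)⁻¹ * (t * quadSym ε ξ) := by
  have hv : ⟪e, (v : Eucl n)⟫ = 0 := Submodule.mem_orthogonal_singleton_iff_inner_right.1 v.2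
  have hee : ⟪e, e⟫ = 1 := by simp [he]
  rw [timeFreq, inner_add_left, inner_add_right, inner_add_right, inner_smul_left, inner_smul_left,
    inner_smul_right, inner_smul_right, hv, hee, real_inner_comm e ξ]
  simp
  ring

end Geometry

section Smoothing

variable {n : ℕ}

/-- Local smoothing on a hyperplane for frequencies on which `|ξ·e_±|` is bounded below. -/
lemma eLpNorm_fourierInv_propSymbol_le (ε : Fin n → ℝ) {e : Eucl n} (he : ‖e‖ = 1) {c : ℝ}
    (hc : 0 < c) {g : Eucl n → ℂ} (hg : Integrable g) (hg2 : MemLp g 2)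
    (hsupp : ∀ ξ, |⟪ξ, epm ε e⟫| < c → g ξ = 0) (r : ℝ) :
    eLpNorm (fun p : ℝ × hyperplane e =>
        𝓕⁻ (fun ξ => propSymbol ε p.1 ξ * g ξ) (r • e + (p.2 : Eucl n))) 2 volume
      ≤ 2 * (ENNReal.ofReal (√(c / Real.pi))⁻¹ * eLpNorm g 2 volume) := by
  set a : Eucl n → ℂ := fun ξ => Complex.exp (((2 * Real.pi * (r * ⟪ξ, e⟫) : ℝ) : ℂ) * Complex.I)
  have ha : Continuous a := by fun_prop
  have ha1 : ∀ ξ, ‖a ξ‖ = 1 := fun ξ => Complex.norm_exp_ofReal_mul_I _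
  set h : Eucl n → ℂ := fun ξ => a ξ * g ξ
  have hnorm : ∀ ξ, ‖h ξ‖ = ‖g ξ‖ := fun ξ => by simp [h, ha1]
  have hh : Integrable h := hg.bdd_mul ha.aestronglyMeasurable (.of_forall fun ξ => (ha1 ξ).le)
  have hh2 : MemLp h 2 := hg2.congr_norm hh.1 (.of_forall fun ξ => (hnorm ξ).symm)
  have hhg : eLpNorm h 2 volume = eLpNorm g 2 volume :=
    eLpNorm_congr_norm_ae (.of_forall hnorm)
  set A : Set (Eucl n) := {ξ | c ≤ ⟪ξ, epm ε e⟫}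
  set B : Set (Eucl n) := {ξ | ⟪ξ, epm ε e⟫ ≤ -c}
  have hA : MeasurableSet A := (isClosed_le continuous_const (by fun_prop)).measurableSet
  have hB : MeasurableSet B := (isClosed_le (by fun_prop) continuous_const).measurableSet
  have hdisj : Disjoint A B := Set.disjoint_left.2 fun ξ h1 h2 => by
    simp only [A, B, Set.mem_ofPred_eq] at h1 h2
    linarith
  have hdet : ∀ ξ, c ≤ |⟪ξ, epm ε e⟫| → c / Real.pi ≤ |(timeFreqDeriv ε e ξ).det| := by
    intro ξ hξ
    rw [det_timeFreqDeriv ε he, abs_neg, abs_div, abs_of_pos Real.pi_pos]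
    gcongr
  have hder : ∀ (H : Set (Eucl n)), ∀ ξ ∈ H,
      HasFDerivWithinAt (timeFreq ε e) (timeFreqDeriv ε e ξ) H ξ :=
    fun H ξ _ => (hasFDerivAt_timeFreq ε e ξ).hasFDerivWithinAt
  obtain ⟨hAc, hAb⟩ := eLpNorm_oscillatory_integral_le hA (hder A)
    (timeFreq_injOn ε he fun ξ hξ η hη => by
      simp only [A, Set.mem_ofPred_eq] at hξ hη
      linarith)
    (div_pos hc Real.pi_pos) (fun ξ hξ => hdet ξ (hξ.trans (le_abs_self _))) hh.integrableOn hh2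
  obtain ⟨hBc, hBb⟩ := eLpNorm_oscillatory_integral_le hB (hder B)
    (timeFreq_injOn ε he fun ξ hξ η hη => by
      simp only [B, Set.mem_ofPred_eq] at hξ hη
      linarith)
    (div_pos hc Real.pi_pos)
    (fun ξ hξ => hdet ξ ((le_neg_of_le_neg hξ).trans (neg_le_abs _))) hh.integrableOn hh2
  set FA : Eucl n → ℂ := fun w =>
    ∫ ξ in A, Complex.exp (↑(2 * Real.pi * ⟪timeFreq ε e ξ, w⟫) * Complex.I) • h ξ
  set FB : Eucl n → ℂ := fun w =>
    ∫ ξ in B, Complex.exp (↑(2 * Real.pi * ⟪timeFreq ε e ξ, w⟫) * Complex.I) • h ξ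
  have hsplit : (fun p : ℝ × hyperplane e =>
      𝓕⁻ (fun ξ => propSymbol ε p.1 ξ * g ξ) (r • e + (p.2 : Eucl n)))
      = (FA + FB) ∘ (fun p : ℝ × hyperplane e => p.1 • e + (p.2 : Eucl n)) := by
    ext ⟨t, v⟩
    set w : Eucl n := t • e + (v : Eucl n)
    have hT : Continuous (timeFreq ε e) :=
      continuous_iff_continuousAt.2 fun ξ => (hasFDerivAt_timeFreq ε e ξ).continuousAt
    have hint : Integrable fun ξ =>
        Complex.exp (↑(2 * Real.pi * ⟪timeFreq ε e ξ, w⟫) * Complex.I) • h ξ :=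
      hh.bdd_mul (by fun_prop) (.of_forall fun ξ => (Complex.norm_exp_ofReal_mul_I _).le)
    have hphase : ∀ ξ, Complex.exp (↑(2 * Real.pi * ⟪ξ, r • e + (v : Eucl n)⟫) * Complex.I) •
        (propSymbol ε t ξ * g ξ)
        = Complex.exp (↑(2 * Real.pi * ⟪timeFreq ε e ξ, w⟫) * Complex.I) • h ξ := by
      intro ξ
      simp only [h, a, propSymbol, smul_eq_mul, ← mul_assoc, ← Complex.exp_add]
      congr 2
      rw [inner_timeFreq ε he, inner_add_right, inner_smul_right]
      have : (Real.pi : ℂ) ≠ 0 := Complex.ofReal_ne_zero.2 Real.pi_ne_zero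
      push_cast
      field_simp
      ring
    simp only [Function.comp_apply, Pi.add_apply, FA, FB]
    rw [Real.fourierInv_eq', ← setIntegral_union hdisj hB hint.integrableOn hint.integrableOn]
    simp only [hphase]
    refine (setIntegral_eq_integral_of_forall_compl_eq_zero fun ξ hξ => ?_).symm
    have : g ξ = 0 := hsupp ξ <| by
      simp only [A, B, Set.mem_union, Set.mem_ofPred_eq, not_or, not_le] at hξ
      exact abs_lt.2 ⟨hξ.2, hξ.1⟩
    simp [h, this]
  rw [hsplit, eLpNorm_comp_measurePreserving (hAc.add hBc).aestronglyMeasurable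
    (measurePreserving_line_add_hyperplane he), two_mul, ← hhg]
  exact (eLpNorm_add_le hAc.aestronglyMeasurable hBc.aestronglyMeasurable one_le_two).trans
    (add_le_add hAb hBb)

lemma dirSymbol_eq_zero {χ : ℝ → ℝ} (hχ : IsBump χ) {d : Eucl n} {j l : ℤ} {ξ : Eucl n}
    (h : |⟪ξ, d⟫| ≤ 2 ^ (j - l - 1)) : dirSymbol χ d j l ξ = 0 := by
  rw [dirSymbol, psiGe_eq_zero hχ h]
  simp

lemma inv_sqrt_zpow_div_pi (j : ℤ) (b : ℤ) :
    (√((2 : ℝ) ^ (j - b) / Real.pi))⁻¹ = √(Real.pi * 2 ^ b) * (2 : ℝ) ^ (-(j : ℝ) / 2) := by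
  have h1 : (2 : ℝ) ^ (-(j : ℝ) / 2) = √((2 : ℝ) ^ (-j)) := by
    rw [Real.sqrt_eq_rpow, ← Real.rpow_intCast, ← Real.rpow_mul two_pos.le]
    push_cast
    ring_nf
  rw [h1, ← Real.sqrt_mul (by positivity), ← Real.sqrt_inv, inv_div, mul_assoc,
    ← zpow_add₀ two_ne_zero, div_eq_mul_inv, ← zpow_neg]
  ring_nf

end Smoothing

/-- frequency-localized smoothing
`‖P_j Q^{e_±}_{j,10} W_±(t)φ‖_{L^{∞,2}_e} ≤ C 2^{-j/2}‖φ‖_{L²}`. -/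
theorem freq_localized_smoothing
    (n : ℕ) (hn : 2 ≤ n) (ε : Fin n → ℝ) (hε : ∀ i, ε i = 1 ∨ ε i = -1)
    (χ : ℝ → ℝ) (hχ : IsBump χ) :
    ∃ C : ℝ, 0 < C ∧ ∀ (j : ℤ) (e : Eucl n), ‖e‖ = 1 → ∀ φ : Eucl n → ℂ, MemLp φ 2 volume →
      aniNorm ∞ 2 e
        (fun p : ℝ × Eucl n => proj χ j (qproj χ (epm ε e) j 10 (prop ε p.1 φ)) p.2)
      ≤ ENNReal.ofReal C * tp (-(j : ℝ) / 2) * eLpNorm φ 2 volume := by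
  obtain ⟨M, hM⟩ := hχ.exists_abs_le
  have hM1 : 1 ≤ M := by simpa [hχ.one 0 (by simp)] using hM 0
  refine ⟨2 * √(Real.pi * 2 ^ (11 : ℤ)) * (2 * M * (1 + M)), by positivity, ?_⟩
  intro j e he φ hφ
  rw [aniNorm, if_pos rfl]
  refine essSup_le_of_ae_le _ (.of_forall fun r => ?_)
  rw [innerQ]
  by_cases hf : Integrable (𝓕 φ)
  · have hc : Continuous (𝓕 φ) := by
      by_cases h : Integrable φ
      · exact continuous_fourier_of_integrable h
      · rw [fourier_eq_zero_of_not_integrable h]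
        exact continuous_const
    have hle : eLpNorm (𝓕 φ) 2 volume ≤ eLpNorm φ 2 volume := eLpNorm_fourier_le hφ
    set g : Eucl n → ℂ := fun ξ => dirSymbol χ (epm ε e) j 10 ξ * 𝓕 φ ξ
    have hK : ∀ ξ, ‖dirSymbol χ (epm ε e) j 10 ξ‖ ≤ 2 * M * (1 + M) :=
      norm_dirSymbol_le hχ hM _ j 10
    have hg : Integrable g :=
      hf.bdd_mul (hχ.continuous_dirSymbol _ j 10).aestronglyMeasurable (.of_forall hK)
    have hgle : eLpNorm g 2 volume ≤ ENNReal.ofReal (2 * M * (1 + M)) * eLpNorm φ 2 volume := by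
      refine (eLpNorm_le_mul_eLpNorm_of_ae_le_mul (c := 2 * M * (1 + M)) (g := 𝓕 φ)
        (.of_forall fun ξ => ?_) 2).trans (by gcongr)
      rw [norm_mul]
      gcongr
      exact hK ξ
    have hg2 : MemLp g 2 :=
      ⟨hg.1, hgle.trans_lt (ENNReal.mul_lt_top ENNReal.ofReal_lt_top hφ.2)⟩
    have hsm := eLpNorm_fourierInv_propSymbol_le ε he (c := 2 ^ (j - 10 - 1)) (by positivity) hg hg2
      (fun ξ hξ => by simp [g, dirSymbol_eq_zero hχ hξ.le]) r
    calc _ ≤ eLpNorm (fun p : ℝ × hyperplane e =>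
          𝓕⁻ (fun ξ => propSymbol ε p.1 ξ * g ξ) (r • e + (p.2 : Eucl n))) 2 volume := by
          refine eLpNorm_mono fun p => ?_
          refine (norm_proj_qproj_prop_le hχ ε (epm ε e) j 10 p.1 hc hf _).trans_eq ?_
          simp only [g, mul_left_comm]
      _ ≤ 2 * (ENNReal.ofReal (√((2 : ℝ) ^ (j - 11) / Real.pi))⁻¹
            * (ENNReal.ofReal (2 * M * (1 + M)) * eLpNorm φ 2 volume)) := by
          refine hsm.trans ?_
          rw [sub_sub]
          norm_num only
          gcongr
      _ = _ := by
          rw [inv_sqrt_zpow_div_pi, tp, ENNReal.ofReal_mul (by positivity),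
            ENNReal.ofReal_mul (by positivity : 0 ≤ 2 * √(Real.pi * 2 ^ (11 : ℤ))),
            ENNReal.ofReal_mul two_pos.le, ENNReal.ofReal_ofNat]
          ring
  · simp only [proj_qproj_prop_eq_zero χ ε _ j 10 _ hf, Pi.zero_apply]
    simp
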